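/- Let k be an infinite field and let d ≥ 5. For general forms f₁, f₂, f₃ of degree d in R = k[x,y], setting I = (f₁, f₂, f₃) with minimal reduction J ⊆ I generated by two general k-linear combinations of f₁, f₂, f₃: if Σ_{ℓ=3}^{d−1} λ(I^ℓ / J I^{ℓ−1}) > d(d−2)/8 + max{d/2 − 5, 0} when d is even, respectively Σ_{ℓ=3}^{d−1} λ(I^ℓ / J I^{ℓ−1}) > (d+1)(d−1)/8 − 2 when d is odd, then the Rees algebra R[It] of I has depth one. -/

import Mathlib

open MvPolynomial

set_option synthInstance.maxHeartbeats 1000000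

noncomputable section

/-- The binary form of degree `d` in `k[x,y]` with coefficient vector `c`
(`x := X 0`, `y := X 1`). -/
def formOf {k : Type*} [Field k] (d : ℕ) (c : Fin (d + 1) → k) :
    MvPolynomial (Fin 2) k :=
  ∑ l : Fin (d + 1), C (c l) * X 0 ^ (l : ℕ) * X 1 ^ (d - (l : ℕ))

/-- `J` is a reduction of `I` : `J ⊆ I` and `I^{n+1} = J·I^n` for some `n`. -/
def IsReduction {A : Type*} [CommRing A] (I J : Ideal A) : Prop :=
  J ≤ I ∧ ∃ n : ℕ, I ^ (n + 1) = J * I ^ n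

/-- `J` is a minimal reduction of `I` : a reduction minimal w.r.t. inclusion. -/
def IsMinimalReduction {A : Type*} [CommRing A] (I J : Ideal A) : Prop :=
  IsReduction I J ∧ ∀ J' : Ideal A, IsReduction I J' → J' ≤ J → J' = J

/-- The length `λ(M)` of a module: the supremum of the lengths of strictly
increasing chains of submodules (the height of `⊤` in the submodule lattice). -/
def moduleLength (A M : Type*) [CommRing A] [AddCommGroup M] [Module A M] : ℕ∞ :=
  Order.height (⊤ : Submodule A M)

/-- The `A`-module `I^ℓ / J·I^{ℓ-1}`. -/
abbrev powQuot {A : Type*} [CommRing A] (I J : Ideal A) (ℓ : ℕ) :=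
  ↥(I ^ ℓ) ⧸ Submodule.comap (I ^ ℓ).subtype (J * I ^ (ℓ - 1))

/-- The bound of the Huckaba–Marley test in Proposition `aci_general`:
`d(d−2)/8 + max{d/2 − 5, 0}` if `d` is even, `(d+1)(d−1)/8 − 2` if `d` is odd
(all divisions and subtractions are exact/truncated, matching the stated values). -/
def HMbound (d : ℕ) : ℕ :=
  if Even d then d * (d - 2) / 8 + (d / 2 - 5) else (d + 1) * (d - 1) / 8 - 2

/-- The graded maximal ideal `𝓜 = (x, y, ⊕_{ℓ≥1} I^ℓ t^ℓ)` of the Rees algebra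
`R[It] ⊆ R[t]` of an ideal `I ⊆ k[x,y]`. -/
def reesMax {k : Type*} [Field k] (I : Ideal (MvPolynomial (Fin 2) k)) :
    Ideal (reesAlgebra I) :=
  Ideal.comap
    ((Polynomial.evalRingHom (0 : MvPolynomial (Fin 2) k)).comp
      (reesAlgebra I).val.toRingHom)
    (Ideal.span {X 0, X 1})

/-- The set of lengths of `𝓜`-regular sequences on the Rees algebra `R[It]`;
the depth of `R[It]` with respect to `𝓜` is its supremum. -/
def reesDepthSet {k : Type*} [Field k] (I : Ideal (MvPolynomial (Fin 2) k)) : Set ℕ :=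
  {n | ∃ rs : List (reesAlgebra I), rs.length = n ∧ (∀ r ∈ rs, r ∈ reesMax I) ∧
    RingTheory.Sequence.IsRegular (reesAlgebra I) rs}

/-- Specialisation of the coefficients of a polynomial with indeterminate coefficients. -/
def specialize {k σ : Type*} [Field k] (v : σ → k) :
    MvPolynomial (Fin 2) (MvPolynomial σ k) →ₐ[k] MvPolynomial (Fin 2) k :=
  mapAlgHom (aeval v)

lemma coeff_specialize {k σ : Type*} [Field k] (v : σ → k)
    (p : MvPolynomial (Fin 2) (MvPolynomial σ k)) (s : Fin 2 →₀ ℕ) :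
    coeff s (specialize v p) = eval v (coeff s p) := by
  simp [specialize, coeff_map, coe_aeval_eq_eval]

/-- Spanning all forms of degree `D` is an open condition on the coefficients. -/
lemma exists_ne_zero_forall_homogeneousSubmodule_le {k σ : Type*} [Field k]
    (N : Submodule k (MvPolynomial (Fin 2) (MvPolynomial σ k))) (D : ℕ)
    (hN : ∀ v, N.map (specialize v).toLinearMap ≤ homogeneousSubmodule (Fin 2) k D)
    (v₀ : σ → k)
    (h₀ : homogeneousSubmodule (Fin 2) k D ≤ N.map (specialize v₀).toLinearMap) :
    ∃ P : MvPolynomial σ k, P ≠ 0 ∧ ∀ v, eval v P ≠ 0 →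
      homogeneousSubmodule (Fin 2) k D ≤ N.map (specialize v).toLinearMap := by
  classical
  let ι := {s : Fin 2 →₀ ℕ // s.degree = D}
  have : Finite ι := ((Finsupp.finite_of_degree_le (σ := Fin 2) D).subset fun s hs => le_of_eq hs)
  have : Fintype ι := Fintype.ofFinite ι
  have hG : ∀ s : ι, ∃ G ∈ N, specialize v₀ G = monomial s.1 1 := fun s =>
    h₀ (isHomogeneous_monomial 1 s.2)
  choose G hGN hG using hG
  let M : Matrix ι ι (MvPolynomial σ k) := fun s t => coeff t.1 (G s)
  have hM : ∀ v s t, (M.map (eval v)) s t = coeff t.1 (specialize v (G s)) := fun v s t => by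
    rw [coeff_specialize]; rfl
  have hdet : ∀ v, eval v M.det = (M.map (eval v)).det := fun v => RingHom.map_det _ _
  refine ⟨M.det, fun h => ?_, fun v hv p hp => ?_⟩
  · have h1 : M.map (eval v₀) = 1 := by
      ext s t
      rw [hM, hG, coeff_monomial, Matrix.one_apply]
      exact if_congr Subtype.ext_iff.symm rfl rfl
    have := hdet v₀
    rw [h, h1] at this
    simp at this
  · rw [hdet] at hv
    have hinv := Matrix.nonsing_inv_mul (M.map (eval v)) (Ne.isUnit hv)
    set M' := (M.map (eval v))⁻¹
    have hmem : ∀ s, specialize v (G s) ∈ N.map (specialize v).toLinearMap := fun s =>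
      ⟨G s, hGN s, rfl⟩
    have key : p = ∑ t : ι, ∑ s : ι, (coeff t.1 p * M' t s) • specialize v (G s) := by
      ext u
      by_cases hu : u.degree = D
      · simp only [coeff_sum, coeff_smul, smul_eq_mul]
        have : ∀ t : ι, ∑ s : ι, coeff t.1 p * M' t s * coeff u (specialize v (G s)) =
            if t = ⟨u, hu⟩ then coeff t.1 p else 0 := by
          intro t
          have := congrFun (congrFun hinv t) ⟨u, hu⟩
          rw [Matrix.mul_apply, Matrix.one_apply] at this
          simp only [hM] at this
          simp only [mul_assoc, ← Finset.mul_sum, this]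
          simp
        rw [Finset.sum_congr rfl fun t _ => this t]
        refine .symm ((Finset.sum_eq_single_of_mem (⟨u, hu⟩ : ι) (Finset.mem_univ _) ?_).trans ?_)
        · exact fun t _ ht => if_neg ht
        · exact if_pos rfl
      · rw [IsHomogeneous.coeff_eq_zero hp hu, IsHomogeneous.coeff_eq_zero _ hu]
        exact Submodule.sum_mem (homogeneousSubmodule (Fin 2) k D) fun t _ =>
          Submodule.sum_mem _ fun s _ => Submodule.smul_mem _ _ (hN v (hmem s))
    rw [key]
    exact Submodule.sum_mem _ fun t _ => Submodule.sum_mem _ fun s _ =>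
      Submodule.smul_mem _ _ (hmem s)

section Example

variable {k R : Type*} [Field k] [CommRing R] [Algebra k R]

/-- The key recursion: `x^{s+1} y^{(d-1)s}` lies in `⟨x, y⟩ ⟨x^d, y^d, x^{d-1}y + xy^{d-1}⟩^s`. -/
lemma pow_mul_pow_mem_mul_pow {L V : Submodule k R} {x y : R} {e : ℕ} (hx : x ∈ L) (hy : y ∈ L)
    (h₁ : x ^ (e + 1) ∈ V) (h₂ : y ^ (e + 1) ∈ V) (h₃ : x ^ e * y + x * y ^ e ∈ V) :
    ∀ s, x ^ (s + 1) * y ^ (e * s) ∈ L * V ^ s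
  | 0 => by simpa using hx
  | 1 => by
    have : x ^ (1 + 1) * y ^ (e * 1) = x * (x ^ e * y + x * y ^ e) - y * x ^ (e + 1) := by ring
    rw [this, pow_one]
    exact sub_mem (Submodule.mul_mem_mul hx h₃) (Submodule.mul_mem_mul hy h₁)
  | s + 2 => by
    have a := pow_mul_pow_mem_mul_pow hx hy h₁ h₂ h₃ s
    have b := pow_mul_pow_mem_mul_pow hx hy h₁ h₂ h₃ (s + 1)
    have : x ^ (s + 2 + 1) * y ^ (e * (s + 2)) =
        (x ^ (s + 1 + 1) * y ^ (e * (s + 1))) * (x ^ e * y + x * y ^ e) -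
        (x ^ (s + 1) * y ^ (e * s)) * x ^ (e + 1) * y ^ (e + 1) := by ring
    rw [this]
    refine sub_mem ?_ ?_
    · rw [pow_succ V, ← mul_assoc]
      exact Submodule.mul_mem_mul b h₃
    · rw [pow_succ V, pow_succ V, ← mul_assoc, ← mul_assoc]
      exact Submodule.mul_mem_mul (Submodule.mul_mem_mul a h₁) h₂

lemma pow_mul_pow_mem_mul_pow_of_add_eq {L V : Submodule k R} {x y : R} {e : ℕ} (he : 0 < e)
    (hx : x ∈ L) (hy : y ∈ L)
    (h₁ : x ^ (e + 1) ∈ V) (h₂ : y ^ (e + 1) ∈ V) (h₃ : x ^ e * y + x * y ^ e ∈ V)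
    {p q : ℕ} (hpq : p + q = (e + 1) * (e + 1) + 1) : x ^ p * y ^ q ∈ L * V ^ (e + 1) := by
  have main : ∀ a b s n, a + b + s = n → ∀ w ∈ L * V ^ s,
      w * (x ^ (e + 1)) ^ a * (y ^ (e + 1)) ^ b ∈ L * V ^ n := by
    rintro a b s n rfl w hw
    have : L * V ^ (a + b + s) = L * V ^ s * V ^ a * V ^ b := by ring
    rw [this]
    exact Submodule.mul_mem_mul (Submodule.mul_mem_mul hw (Submodule.pow_mem_pow _ h₁ _))
      (Submodule.pow_mem_pow _ h₂ _)
  obtain ⟨a, i, hi, rfl⟩ : ∃ a i, i < e + 1 ∧ p = (e + 1) * a + i :=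
    ⟨p / (e + 1), p % (e + 1), Nat.mod_lt _ (by omega), (Nat.div_add_mod _ _).symm⟩
  obtain ⟨b, j, hj, rfl⟩ : ∃ b j, j < e + 1 ∧ q = (e + 1) * b + j :=
    ⟨q / (e + 1), q % (e + 1), Nat.mod_lt _ (by omega), (Nat.div_add_mod _ _).symm⟩
  have hsum : (e + 1) * (a + b) + (i + j) = (e + 1) * (e + 1) + 1 := by
    rw [← hpq]; ring
  have hab : a + b = e + 1 ∧ i + j = 1 ∨ a + b = e ∧ i + j = e + 2 := by
    have h1 : a + b < e + 2 := by
      by_contra! h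
      have := Nat.mul_le_mul_left (e + 1) h
      nlinarith
    have h2 : e ≤ a + b := by
      by_contra! h
      have : (e + 1) * (a + b) ≤ (e + 1) * (e - 1) := Nat.mul_le_mul_left (e + 1) (by omega)
      obtain ⟨e, rfl⟩ := Nat.exists_eq_succ_of_ne_zero he.ne'
      simp at this
      nlinarith
    rcases (by omega : a + b = e + 1 ∨ a + b = e) with h | h
    · left; refine ⟨h, ?_⟩; rw [h] at hsum; omega
    · right; refine ⟨h, ?_⟩; rw [h] at hsum; nlinarith
  rcases hab with ⟨hab, hij⟩ | ⟨hab, hij⟩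
  · have hz : x ^ i * y ^ j ∈ L * V ^ 0 := by
      rcases (by omega : i = 1 ∧ j = 0 ∨ i = 0 ∧ j = 1) with ⟨rfl, rfl⟩ | ⟨rfl, rfl⟩ <;>
        simpa
    have := main a b 0 (e + 1) (by omega) _ hz
    convert this using 1
    ring
  · obtain ⟨i, rfl⟩ : ∃ i', i = i' + 2 := ⟨i - 2, by omega⟩
    obtain ⟨j, rfl⟩ : ∃ j', j = j' + 2 := ⟨j - 2, by omega⟩
    have he' : e = i + j + 2 := by omega
    by_cases hb : i ≤ b
    · obtain ⟨b, rfl⟩ := Nat.exists_eq_add_of_le hb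
      have := main a b (i + 1) (e + 1) (by omega) _
        (pow_mul_pow_mem_mul_pow hx hy h₁ h₂ h₃ (i + 1))
      convert this using 1
      subst he'
      ring
    · obtain ⟨a, rfl⟩ := Nat.exists_eq_add_of_le (show j ≤ a by omega)
      have := main a b (j + 1) (e + 1) (by omega) _
        (pow_mul_pow_mem_mul_pow hy hx h₂ h₁ (by convert h₃ using 1; ring) (j + 1))
      convert this using 1
      subst he'
      ring

end Example

section SpanIdeal

variable {k R : Type*} [Field k] [CommRing R] [Algebra k R]

lemma idealSpan_coe_mul (N N' : Submodule k R) :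
    Ideal.span ((N * N' : Submodule k R) : Set R) = Ideal.span (N : Set R) * Ideal.span N' := by
  apply le_antisymm
  · rw [Ideal.span_le]
    intro z hz
    refine Submodule.mul_induction_on hz (fun a ha b hb => ?_) fun a b ha hb => add_mem ha hb
    exact Ideal.mul_mem_mul (Ideal.subset_span ha) (Ideal.subset_span hb)
  · rw [Ideal.span_mul_span', Ideal.span_le]
    rintro _ ⟨a, ha, b, hb, rfl⟩
    exact Ideal.subset_span (Submodule.mul_mem_mul ha hb)

lemma idealSpan_coe_pow (N : Submodule k R) (n : ℕ) :
    Ideal.span ((N ^ n : Submodule k R) : Set R) = Ideal.span (N : Set R) ^ n := by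
  induction n with
  | zero =>
    rw [pow_zero, pow_zero, Ideal.one_eq_top, Ideal.eq_top_iff_one]
    exact Ideal.subset_span (Submodule.one_le.1 le_rfl)
  | succ n ih => rw [pow_succ, idealSpan_coe_mul, ih, pow_succ]

end SpanIdeal

lemma idealSpan_homogeneousSubmodule {k : Type*} [Field k] (D : ℕ) :
    Ideal.span (homogeneousSubmodule (Fin 2) k D : Set (MvPolynomial (Fin 2) k)) =
      idealOfVars (Fin 2) k ^ D := by
  rw [← homogeneousSubmodule_one_pow, idealSpan_coe_pow, homogeneousSubmodule_one_eq_span_X]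
  congr 1
  exact Submodule.span_span_of_tower k (MvPolynomial (Fin 2) k) _

section Reduction

variable {A : Type*} [CommRing A] {I J : Ideal A}

lemma pow_succ_le_mul_pow_sup_span {f : A} (hI : I = J ⊔ Ideal.span {f}) (n : ℕ) :
    I ^ (n + 1) ≤ J * I ^ n ⊔ Ideal.span {f ^ (n + 1)} := by
  have hJ : J ≤ I := hI ▸ le_sup_left
  have hf : f ∈ I := hI ▸ Ideal.mem_sup_right (Ideal.mem_span_singleton_self f)
  induction n with
  | zero => simp [← hI]
  | succ n ih =>
    calc I ^ (n + 1 + 1) = I ^ (n + 1) * I := pow_succ _ _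
      _ ≤ (J * I ^ n ⊔ Ideal.span {f ^ (n + 1)}) * I := Ideal.mul_mono_left ih
      _ = J * I ^ (n + 1) ⊔ Ideal.span {f ^ (n + 1)} * I := by
        rw [Ideal.sup_mul, mul_assoc, ← pow_succ I n]
      _ ≤ _ := by
        refine sup_le le_sup_left ?_
        nth_rw 1 [hI]
        rw [Ideal.mul_sup, Ideal.span_singleton_mul_span_singleton, ← pow_succ]
        refine sup_le_sup ?_ le_rfl
        rw [mul_comm]
        exact Ideal.mul_mono_right ((Ideal.span_singleton_le_iff_mem _).2 (Ideal.pow_mem_pow hf _))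

/-- The determinant trick: if `I` acts on a faithful finite ideal `M` through `J`, and `I` is
obtained from `J` by adding one generator, then `J` is a reduction of `I`. -/
lemma IsReduction.of_mul_le [IsDomain A] {M : Ideal A} {f : A} (hI : I = J ⊔ Ideal.span {f})
    (hM : M.FG) (hM0 : M ≠ ⊥) (h : I * M ≤ J * M) : IsReduction I J := by
  have hJ : J ≤ I := hI ▸ le_sup_left
  have hf : f ∈ I := hI ▸ Ideal.mem_sup_right (Ideal.mem_span_singleton_self f)
  have : Module.Finite A M := Module.Finite.iff_fg.2 hM
  obtain ⟨p, hp, -, hc, h0⟩ :=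
    LinearMap.exists_monic_and_natDegree_eq_and_coeff_mem_pow_and_aeval_eq_zero A
      (algebraMap A (Module.End A M) f) J (by
        rintro _ ⟨z, rfl⟩
        rw [Submodule.mem_smul_top_iff]
        exact h (Ideal.mul_mem_mul hf z.2))
  rw [Polynomial.aeval_algebraMap_apply] at h0
  obtain ⟨z, hz, hz0⟩ := Submodule.exists_mem_ne_zero_of_ne_bot hM0
  have hev : p.eval f = 0 := by
    have := congrArg Subtype.val (LinearMap.congr_fun h0 ⟨z, hz⟩)
    simpa [hz0, Polynomial.aeval_def, Polynomial.eval₂_eq_eval_map] using this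
  have hs : p.natDegree ≠ 0 := by
    intro hs
    rw [hp.natDegree_eq_zero.1 hs] at hev
    simp at hev
  obtain ⟨n, hn⟩ := Nat.exists_eq_succ_of_ne_zero hs
  refine ⟨hJ, n, le_antisymm ?_ ?_⟩
  · refine (pow_succ_le_mul_pow_sup_span hI n).trans (sup_le le_rfl ?_)
    rw [Ideal.span_singleton_le_iff_mem]
    rw [Polynomial.eval_eq_sum_range, Finset.sum_range_succ, hp.coeff_natDegree, one_mul, hn] at hev
    rw [eq_neg_of_add_eq_zero_right hev]
    refine neg_mem (Submodule.sum_mem _ fun i hi => ?_)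
    have hi : i < n + 1 := Finset.mem_range.1 hi
    have h1 : J ^ (p.natDegree - i) * I ^ i ≤ J * I ^ n := by
      obtain ⟨t, rfl⟩ := Nat.exists_eq_add_of_le (Nat.lt_succ_iff.1 hi)
      rw [hn, show (i + t).succ - i = t + 1 by omega, pow_succ', pow_add, mul_comm (I ^ i), mul_assoc]
      exact Ideal.mul_mono_right (Ideal.mul_mono_left (Ideal.pow_right_mono hJ _))
    exact h1 (Ideal.mul_mem_mul (hc i) (Ideal.pow_mem_pow hf i))
  · rw [pow_succ']
    exact Ideal.mul_mono_left hJ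

/-- If `m^N ⊆ J'` and `J ⊆ J' + mJ` then `J ⊆ J'`. -/
lemma Ideal.le_of_le_sup_mul_of_pow_le {J' m : Ideal A} {N : ℕ} (hJ : J.FG) (hN : m ^ N ≤ J')
    (h : J ≤ J' ⊔ m * J) : J ≤ J' := by
  obtain ⟨r, hr, hrJ⟩ := Submodule.exists_sub_one_mem_and_smul_le_of_fg_of_le_sup
    (I := m) (N := J') hJ le_rfl h
  intro z hz
  have hr' : 1 - r ∈ m := by simpa using neg_mem hr
  obtain ⟨s, hs⟩ := sub_dvd_pow_sub_pow 1 (1 - r) N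
  have : z = (1 - r) ^ N * z + s * (r • z) := by
    simp only [sub_sub_cancel, one_pow] at hs
    rw [smul_eq_mul]
    linear_combination z * hs
  rw [this]
  exact add_mem (Ideal.mul_mem_right _ _ (hN (Ideal.pow_mem_pow hr' N)))
    (Ideal.mul_mem_left _ _ (hrJ (Submodule.smul_mem_pointwise_smul _ _ _ hz)))

end Reduction

section Minimal

variable {k : Type*} [Field k]

lemma idealOfVars_ne_top : idealOfVars (Fin 2) k ≠ ⊤ := by
  rw [Ideal.ne_top_iff_one]
  have := (C_mem_pow_idealOfVars_iff (σ := Fin 2) (R := k) 1 1).not.2 (by simp)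
  simpa using this

lemma sub_C_constantCoeff_mem_idealOfVars (p : MvPolynomial (Fin 2) k) :
    p - C (constantCoeff p) ∈ idealOfVars (Fin 2) k := by
  rw [← pow_one (idealOfVars (Fin 2) k), mem_pow_idealOfVars_iff']
  intro x hx
  obtain rfl : x = 0 := (Finsupp.degree_eq_zero_iff x).1 (by lia)
  simp [constantCoeff_eq]

/-- A submodule of a two-generated ideal that does not generate it modulo `m` is
principal modulo `m`. -/
lemma le_sup_mul_or_exists_le_span_sup_mul (g₁ g₂ : MvPolynomial (Fin 2) k)
    {J' : Ideal (MvPolynomial (Fin 2) k)} (h : J' ≤ Ideal.span {g₁, g₂}) :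
    Ideal.span {g₁, g₂} ≤ J' ⊔ idealOfVars (Fin 2) k * Ideal.span {g₁, g₂} ∨
      ∃ w ∈ Ideal.span {g₁, g₂},
        J' ≤ Ideal.span {w} ⊔ idealOfVars (Fin 2) k * Ideal.span {g₁, g₂} := by
  set m := idealOfVars (Fin 2) k
  set J := Ideal.span {g₁, g₂}
  have hg₁ : g₁ ∈ J := Ideal.subset_span (by simp)
  have hg₂ : g₂ ∈ J := Ideal.subset_span (by simp)
  have hrep : ∀ z ∈ J', ∃ a b : k, z - (C a * g₁ + C b * g₂) ∈ m * J := by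
    intro z hz
    obtain ⟨p, q, rfl⟩ := Ideal.mem_span_pair.1 (h hz)
    refine ⟨constantCoeff p, constantCoeff q, ?_⟩
    have : p * g₁ + q * g₂ - (C (constantCoeff p) * g₁ + C (constantCoeff q) * g₂) =
      (p - C (constantCoeff p)) * g₁ + (q - C (constantCoeff q)) * g₂ := by ring
    rw [this]
    exact add_mem (Ideal.mul_mem_mul (sub_C_constantCoeff_mem_idealOfVars p) hg₁)
      (Ideal.mul_mem_mul (sub_C_constantCoeff_mem_idealOfVars q) hg₂)
  choose! a b hab using hrep
  have hmem : ∀ z ∈ J', C (a z) * g₁ + C (b z) * g₂ ∈ J' ⊔ m * J := fun z hz => by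
    have := sub_mem (Ideal.mem_sup_left (T := m * J) hz) (Ideal.mem_sup_right (S := J') (hab z hz))
    rwa [sub_sub_cancel] at this
  by_cases hdet : ∃ z ∈ J', ∃ z' ∈ J', a z * b z' - a z' * b z ≠ 0
  · left
    obtain ⟨z, hz, z', hz', hne⟩ := hdet
    have hC : C ((a z * b z' - a z' * b z)⁻¹) * C (a z * b z' - a z' * b z) =
        (1 : MvPolynomial (Fin 2) k) := by rw [← C_mul, inv_mul_cancel₀ hne, C_1]
    simp only [C_sub, C_mul] at hC
    rw [Ideal.span_le]
    rintro g (rfl | rfl)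
    · have : g = C ((a z * b z' - a z' * b z)⁻¹) * (C (b z') * (C (a z) * g + C (b z) * g₂) -
          C (b z) * (C (a z') * g + C (b z') * g₂)) := by
        linear_combination -g * hC
      rw [this]
      exact Ideal.mul_mem_left _ _ (sub_mem (Ideal.mul_mem_left _ _ (hmem z hz))
        (Ideal.mul_mem_left _ _ (hmem z' hz')))
    · have : g = C ((a z * b z' - a z' * b z)⁻¹) * (C (a z) * (C (a z') * g₁ + C (b z') * g) -
          C (a z') * (C (a z) * g₁ + C (b z) * g)) := by
        linear_combination -g * hC
      rw [this]
      exact Ideal.mul_mem_left _ _ (sub_mem (Ideal.mul_mem_left _ _ (hmem z' hz'))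
        (Ideal.mul_mem_left _ _ (hmem z hz)))
  · right
    push Not at hdet
    have key : ∃ α β : k, ∀ z ∈ J', ∃ t, a z = t * α ∧ b z = t * β := by
      by_cases h0 : ∀ z ∈ J', a z = 0 ∧ b z = 0
      · exact ⟨0, 0, fun z hz => ⟨0, by simp [h0 z hz]⟩⟩
      · push Not at h0
        obtain ⟨z, hz, hne⟩ := h0
        refine ⟨a z, b z, fun z' hz' => ?_⟩
        have := hdet z hz z' hz'
        by_cases haz : a z = 0
        · have hbz := hne haz
          refine ⟨b z' / b z, ?_, by field_simp⟩
          simpa [haz, hbz] using this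
        · refine ⟨a z' / a z, by field_simp, ?_⟩
          field_simp
          linear_combination this
    obtain ⟨α, β, hαβ⟩ := key
    refine ⟨C α * g₁ + C β * g₂, add_mem (Ideal.mul_mem_left _ _ hg₁) (Ideal.mul_mem_left _ _ hg₂),
      fun z hz => ?_⟩
    obtain ⟨t, h1, h2⟩ := hαβ z hz
    have : z = C t * (C α * g₁ + C β * g₂) + (z - (C (a z) * g₁ + C (b z) * g₂)) := by
      rw [h1, h2, C_mul, C_mul]; ring
    rw [this]
    exact add_mem (Ideal.mem_sup_left (Ideal.mul_mem_left _ _ (Ideal.mem_span_singleton_self _)))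
      (Ideal.mem_sup_right (hab z hz))

lemma not_dvd_mul_X_pow {w r : MvPolynomial (Fin 2) k} {N : ℕ}
    (hw : w ∈ idealOfVars (Fin 2) k) (hr : r - 1 ∈ idealOfVars (Fin 2) k)
    (h0 : w ∣ r * X 0 ^ N) : ¬ w ∣ r * X 1 ^ N := by
  intro h1
  have hrm : r ∉ idealOfVars (Fin 2) k := fun h =>
    idealOfVars_ne_top ((Ideal.eq_top_iff_one _).2 (by simpa using sub_mem h hr))
  have hX : (X 0 : MvPolynomial (Fin 2) k) ^ N ≠ 0 := pow_ne_zero _ (X_ne_zero _)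
  have hrel : IsRelPrime ((X 0 : MvPolynomial (Fin 2) k) ^ N) (X 1 ^ N) := by
    apply IsRelPrime.pow
    rw [X_prime.irreducible.isRelPrime_iff_not_dvd]
    simp [X_dvd_X]
  obtain ⟨p, hp⟩ := h0
  obtain ⟨q, hq⟩ := h1
  have hw0 : w ≠ 0 := by
    rintro rfl
    simp only [zero_mul, mul_eq_zero, hX, or_false] at hp
    exact hrm (hp ▸ Ideal.zero_mem _)
  have hpq : p * X 1 ^ N = q * X 0 ^ N :=
    mul_left_cancel₀ hw0 (by linear_combination X 0 ^ N * hq - X 1 ^ N * hp)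
  obtain ⟨p', rfl⟩ := hrel.dvd_of_dvd_mul_right (Dvd.intro_left q hpq.symm)
  have : r = w * p' := mul_right_cancel₀ hX (by linear_combination hp)
  exact hrm (this ▸ Ideal.mul_mem_right _ _ hw)

/-- A two-generated reduction of an ideal of finite colength in `k[x,y]` is minimal. -/
lemma IsReduction.isMinimalReduction {I : Ideal (MvPolynomial (Fin 2) k)}
    {g₁ g₂ : MvPolynomial (Fin 2) k} {N : ℕ} (hred : IsReduction I (Ideal.span {g₁, g₂}))
    (hm : Ideal.span {g₁, g₂} ≤ idealOfVars (Fin 2) k) (hN : idealOfVars (Fin 2) k ^ N ≤ I) :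
    IsMinimalReduction I (Ideal.span {g₁, g₂}) := by
  refine ⟨hred, fun J' hJ' hle => le_antisymm hle ?_⟩
  obtain ⟨hJ'I, n, hn⟩ := hJ'
  have hpow : idealOfVars (Fin 2) k ^ (N * (n + 1)) ≤ I ^ (n + 1) := by
    rw [pow_mul]; exact Ideal.pow_right_mono hN _
  refine Ideal.le_of_le_sup_mul_of_pow_le (IsNoetherian.noetherian _)
    (hpow.trans (hn.le.trans Ideal.mul_le_left)) ?_
  refine (le_sup_mul_or_exists_le_span_sup_mul g₁ g₂ hle).resolve_right ?_
  rintro ⟨w, hw, hJ'w⟩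
  have hsup : I ^ (n + 1) ≤ Ideal.span {w} ⊔ idealOfVars (Fin 2) k • I ^ (n + 1) := by
    calc I ^ (n + 1) = J' * I ^ n := hn
      _ ≤ _ := Ideal.mul_mono_left hJ'w
      _ ≤ _ := by
        rw [Ideal.sup_mul, mul_assoc]
        refine sup_le_sup Ideal.mul_le_left ?_
        rw [smul_eq_mul, pow_succ']
        exact Ideal.mul_mono_right (Ideal.mul_mono_left hred.1)
  obtain ⟨r, hr, hrI⟩ := Submodule.exists_sub_one_mem_and_smul_le_of_fg_of_le_sup
    (IsNoetherian.noetherian _) le_rfl hsup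
  have hX : ∀ i, w ∣ r * X i ^ (N * (n + 1)) := fun i => Ideal.mem_span_singleton.1 <|
    hrI (Submodule.smul_mem_pointwise_smul _ _ _
      (hpow (Ideal.pow_mem_pow (Ideal.subset_span (Set.mem_range_self i)) _)))
  exact not_dvd_mul_X_pow (hm hw) hr (hX 0) (hX 1)

end Minimal

section Depth

variable {k : Type*} [Field k] {I : Ideal (MvPolynomial (Fin 2) k)}

/-- In a domain, if `b` is regular modulo `a`, then powers of `b` are regular modulo powers
of `a`. -/
lemma pow_dvd_of_pow_dvd_pow_mul {B : Type*} [CommRing B] [IsDomain B] {a b : B} (ha : a ≠ 0)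
    (h : ∀ z, a ∣ b * z → a ∣ z) (K L : ℕ) {z : B} (hz : a ^ K ∣ b ^ L * z) : a ^ K ∣ z := by
  have h1 : ∀ (L : ℕ) z, a ∣ b ^ L * z → a ∣ z := by
    intro L
    induction L with
    | zero => simp
    | succ L ih => exact fun z hz => ih z (h _ (by rwa [← mul_assoc, ← pow_succ']))
  induction K generalizing z with
  | zero => simp
  | succ K ih =>
    obtain ⟨w, rfl⟩ := h1 L z ((dvd_pow_self a (Nat.succ_ne_zero K)).trans hz)
    rw [pow_succ']
    refine mul_dvd_mul_left a (ih ?_)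
    rw [pow_succ', mul_left_comm] at hz
    exact (mul_dvd_mul_iff_left ha).1 hz

lemma C_mul_X_mul_mem_reesAlgebra {A : Type*} [CommRing A] {I : Ideal A} {p : Polynomial A} {h : A}
    (hp : ∀ j, p.coeff j * h ∈ I ^ (j + 1)) :
    p * (Polynomial.C h * Polynomial.X) ∈ reesAlgebra I := by
  rw [mem_reesAlgebra_iff]
  rintro (_ | j)
  · simp
  · rw [← mul_assoc, Polynomial.coeff_mul_X, Polynomial.coeff_mul_C]
    exact hp j

/-- An element `ht` outside `R[It]` that is multiplied into `R[It]` by a power of every element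
of `𝓜` obstructs regular sequences of length two. -/
lemma le_one_of_mem_reesDepthSet {h : MvPolynomial (Fin 2) k} (hI : h ∉ I)
    (H : ∀ a ∈ reesMax I, ∃ K, ∀ j, ((a : Polynomial _) ^ K).coeff j * h ∈ I ^ (j + 1))
    {n : ℕ} (hn : n ∈ reesDepthSet I) : n ≤ 1 := by
  obtain ⟨rs, rfl, hrs, hreg⟩ := hn
  match rs, hrs, hreg with
  | [], _, _ => simp
  | [_], _, _ => simp
  | a :: b :: tl, hrs, hreg =>
    exfalso
    rw [RingTheory.Sequence.isRegular_cons_iff, RingTheory.Sequence.isRegular_cons_iff] at hreg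
    obtain ⟨ha, hb, -⟩ := hreg
    have ha0 : a ≠ 0 := by
      rintro rfl
      exact IsSMulRegular.not_zero ha
    have hdvd : ∀ z, a ∣ b * z → a ∣ z := by
      intro z hz
      have hiff : ∀ y : reesAlgebra I,
          (Submodule.Quotient.mk y : QuotSMulTop a (reesAlgebra I)) = 0 ↔ a ∣ y := fun y => by
        rw [Submodule.Quotient.mk_eq_zero, Submodule.mem_smul_pointwise_iff_exists]
        simp [dvd_def, eq_comm]
      rw [← hiff] at hz ⊢
      exact hb (hz.trans (smul_zero b).symm)
    obtain ⟨K, hK⟩ := H a (hrs a (by simp))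
    obtain ⟨L, hL⟩ := H b (hrs b (by simp))
    have hp := C_mul_X_mul_mem_reesAlgebra hK
    have hq := C_mul_X_mul_mem_reesAlgebra hL
    obtain ⟨⟨s, hs⟩, hs'⟩ := pow_dvd_of_pow_dvd_pow_mul ha0 hdvd K L (z := ⟨_, hp⟩)
      ⟨⟨_, hq⟩, Subtype.ext (by simp only [MulMemClass.coe_mul, SubmonoidClass.coe_pow]; ring)⟩
    have hs2 := congrArg Subtype.val hs'
    simp only [MulMemClass.coe_mul, SubmonoidClass.coe_pow] at hs2
    have ha0' : (a : Polynomial (MvPolynomial (Fin 2) k)) ^ K ≠ 0 :=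
      pow_ne_zero _ fun h => ha0 (Subtype.ext h)
    have := mul_left_cancel₀ ha0' hs2
    rw [← this, mem_reesAlgebra_iff] at hs
    exact hI (by simpa using hs 1)

lemma idealOfVars_eq_span_pair : idealOfVars (Fin 2) k = Ideal.span {X 0, X 1} := by
  rw [idealOfVars]
  congr 1
  ext
  simp [Fin.exists_fin_two, eq_comm]

lemma coe_mem_of_mem_reesMax {a : reesAlgebra I} (ha : a ∈ reesMax I) :
    (a : Polynomial (MvPolynomial (Fin 2) k)).coeff 0 ∈ idealOfVars (Fin 2) k := by
  rw [idealOfVars_eq_span_pair, Polynomial.coeff_zero_eq_eval_zero]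
  exact ha

lemma one_mem_reesDepthSet : 1 ∈ reesDepthSet I := by
  let r : reesAlgebra I := algebraMap (MvPolynomial (Fin 2) k) _ (X 0)
  have hr : r ∈ reesMax I := by
    simp only [reesMax, Ideal.mem_comap, r]
    refine Ideal.subset_span ?_
    simp
  have hmax : reesMax I ≠ ⊤ :=
    Ideal.comap_ne_top _ (idealOfVars_eq_span_pair (k := k) ▸ idealOfVars_ne_top)
  refine ⟨[r], rfl, by simpa using hr, ?_⟩
  have hr0 : r ≠ 0 := by
    intro h
    have := congrArg Subtype.val h
    simp [r] at this
  refine { toIsWeaklyRegular := ?_, top_ne_smul := ?_ }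
  · rw [RingTheory.Sequence.isWeaklyRegular_singleton_iff]
    exact fun x y h => mul_left_cancel₀ hr0 h
  · intro h
    apply hmax
    rw [eq_top_iff, h, Ideal.ofList_singleton]
    refine Submodule.smul_le.2 fun a ha b _ => ?_
    exact Ideal.mul_mem_right _ _ (((Ideal.span_singleton_le_iff_mem _).2 hr) ha)

/-- If `R[It]` misses some form of degree `d + 1` in degree one but the powers of `I`
eventually contain all forms of degree `dn + 1`, the Rees algebra has depth one. -/
lemma sSup_reesDepthSet_eq_one {d n₀ : ℕ} (hd : 0 < d) (hId : I ≤ idealOfVars (Fin 2) k ^ d)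
    (hn : ∀ n ≥ n₀, idealOfVars (Fin 2) k ^ (d * n + 1) ≤ I ^ n)
    (hI : ¬ idealOfVars (Fin 2) k ^ (d + 1) ≤ I) : sSup (reesDepthSet I) = 1 := by
  obtain ⟨h, hh, hhI⟩ := SetLike.not_le_iff_exists.1 hI
  refine IsGreatest.csSup_eq ⟨one_mem_reesDepthSet, fun n hn' => ?_⟩
  refine le_one_of_mem_reesDepthSet hhI (fun a ha => ⟨d * n₀ + 1, fun j => ?_⟩) hn'
  have hmem : (a : Polynomial (MvPolynomial (Fin 2) k)) ^ (d * n₀ + 1) ∈ reesAlgebra I :=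
    pow_mem a.2 _
  have hIm : I ≤ idealOfVars (Fin 2) k := hId.trans (Ideal.pow_le_self hd.ne')
  rcases le_or_gt n₀ j with hj | hj
  · refine hn (j + 1) (by omega) ?_
    rw [show d * (j + 1) + 1 = d * j + (d + 1) by ring, pow_add]
    refine Ideal.mul_mem_mul ?_ hh
    rw [pow_mul]
    exact Ideal.pow_right_mono hId j ((mem_reesAlgebra_iff I _).1 hmem j)
  · refine Ideal.mul_mem_right _ _ (Ideal.pow_le_pow_right (show j + 1 ≤ n₀ from hj)
      (hn n₀ le_rfl ?_))
    have hmap : (a : Polynomial (MvPolynomial (Fin 2) k)) ∈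
        Ideal.map Polynomial.C (idealOfVars (Fin 2) k) := by
      rw [Ideal.mem_map_C_iff]
      rintro (_ | i)
      · exact coe_mem_of_mem_reesMax ha
      · exact (Ideal.pow_le_self i.succ_ne_zero).trans hIm ((mem_reesAlgebra_iff I _).1 a.2 (i + 1))
    have := Ideal.pow_mem_pow hmap (d * n₀ + 1)
    rw [← Ideal.map_pow] at this
    exact Ideal.mem_map_C_iff.1 this j

end Depth

section Forms

variable {k : Type*} [Field k]

lemma homogeneousComponent_mul_mem {d : ℕ} {V : Submodule k (MvPolynomial (Fin 2) k)}
    {f : MvPolynomial (Fin 2) k} (hf : f ∈ V) (hfd : f.IsHomogeneous d)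
    (p : MvPolynomial (Fin 2) k) :
    homogeneousComponent (d + 1) (p * f) ∈ homogeneousSubmodule (Fin 2) k 1 * V := by
  have h2 : p - homogeneousComponent 0 p - homogeneousComponent 1 p ∈
      idealOfVars (Fin 2) k ^ 2 := by
    rw [mem_pow_idealOfVars_iff']
    intro x hx
    simp only [coeff_sub, coeff_homogeneousComponent]
    rcases (by omega : x.degree = 0 ∨ x.degree = 1) with h | h <;> simp [h]
  have h3 : (p - homogeneousComponent 0 p - homogeneousComponent 1 p) * f ∈
      idealOfVars (Fin 2) k ^ (2 + d) := by
    rw [pow_add]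
    refine Ideal.mul_mem_mul h2 ?_
    rw [← idealSpan_homogeneousSubmodule]
    exact Ideal.subset_span hfd
  have h4 : homogeneousComponent (d + 1)
      ((p - homogeneousComponent 0 p - homogeneousComponent 1 p) * f) = 0 := by
    rw [mem_pow_idealOfVars_iff'] at h3
    ext x
    rw [coeff_homogeneousComponent]
    split_ifs with hx
    · exact h3 x (by omega)
    · rfl
  have h5 : homogeneousComponent (d + 1) (homogeneousComponent 0 p * f) = 0 := by
    rw [homogeneousComponent_of_mem ((homogeneousComponent_isHomogeneous 0 p).mul hfd),
      if_neg (by omega)]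
  have h6 : homogeneousComponent (d + 1) (homogeneousComponent 1 p * f) =
      homogeneousComponent 1 p * f := by
    rw [homogeneousComponent_of_mem ((homogeneousComponent_isHomogeneous 1 p).mul hfd),
      if_pos (by omega)]
  have : p * f = (p - homogeneousComponent 0 p - homogeneousComponent 1 p) * f +
      homogeneousComponent 0 p * f + homogeneousComponent 1 p * f := by ring
  rw [this, map_add, map_add, h4, h5, h6, zero_add, zero_add]
  exact Submodule.mul_mem_mul (homogeneousComponent_isHomogeneous 1 p) hf

lemma le_finrank_homogeneousSubmodule (D : ℕ) :
    D + 1 ≤ Module.finrank k (homogeneousSubmodule (Fin 2) k D) := by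
  have hfin : Module.Finite k (homogeneousSubmodule (Fin 2) k D) :=
    Module.Finite.iff_fg.2 (homogeneousSubmodule_fg (Fin 2) k D)
  let e : Fin (D + 1) → (Fin 2 →₀ ℕ) := fun i =>
    Finsupp.single 0 (i : ℕ) + Finsupp.single 1 (D - i)
  have he : Function.Injective e := fun i j hij => by
    have := DFunLike.congr_fun hij 0
    simpa [e, Fin.val_inj] using this
  have hdeg : ∀ i, (e i).degree = D := fun i => by
    simp only [e, map_add, Finsupp.degree_single]; omega
  have hli : LinearIndependent k fun i => (monomial (e i) (1 : k)) :=
    (basisMonomials (Fin 2) k).linearIndependent.comp e he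
  have hli' : LinearIndependent k fun i =>
      (⟨monomial (e i) 1, isHomogeneous_monomial 1 (hdeg i)⟩ :
        homogeneousSubmodule (Fin 2) k D) :=
    LinearIndependent.of_comp (homogeneousSubmodule (Fin 2) k D).subtype hli
  simpa using hli'.fintype_card_le_finrank

open scoped Pointwise in
/-- Three forms of degree `d ≥ 5` do not generate all forms of degree `d + 1`. -/
lemma not_pow_idealOfVars_le_span {d : ℕ} (hd : 5 ≤ d) {f : Fin 3 → MvPolynomial (Fin 2) k}
    (hf : ∀ j, (f j).IsHomogeneous d) :
    ¬ idealOfVars (Fin 2) k ^ (d + 1) ≤ Ideal.span (Set.range f) := by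
  classical
  intro h
  have hle : homogeneousSubmodule (Fin 2) k (d + 1) ≤
      homogeneousSubmodule (Fin 2) k 1 * Submodule.span k (Set.range f) := by
    intro q hq
    have hqI : q ∈ Ideal.span (Set.range f) := by
      apply h
      rw [← idealSpan_homogeneousSubmodule]
      exact Ideal.subset_span hq
    obtain ⟨p, hp⟩ := (Ideal.mem_span_range_iff_exists_fun).1 hqI
    rw [← homogeneousComponent_eq_self hq, ← hp, map_sum]
    exact Submodule.sum_mem _ fun j _ =>
      homogeneousComponent_mul_mem (Submodule.subset_span (Set.mem_range_self j)) (hf j) (p j)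
  rw [homogeneousSubmodule_one_eq_span_X, Submodule.span_mul_span] at hle
  have hset : (Set.range (X : Fin 2 → MvPolynomial (Fin 2) k)) * Set.range f =
      Set.range fun p : Fin 2 × Fin 3 => X p.1 * f p.2 := by
    ext z
    simp [Set.mem_mul]
  rw [hset] at hle
  have := Module.Finite.span_of_finite k
    (Set.finite_range fun p : Fin 2 × Fin 3 => (X p.1 : MvPolynomial (Fin 2) k) * f p.2)
  have h1 := Submodule.finrank_mono hle
  have h2 := finrank_range_le_card (R := k)
    (b := fun p : Fin 2 × Fin 3 => (X p.1 : MvPolynomial (Fin 2) k) * f p.2)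
  have h3 := le_finrank_homogeneousSubmodule (k := k) (d + 1)
  simp only [Set.finrank, Fintype.card_prod, Fintype.card_fin] at h2
  omega

/-- The conclusion for explicit forms satisfying the two open conditions. -/
lemma isMinimalReduction_and_sSup_reesDepthSet_eq_one {d : ℕ} (hd : 5 ≤ d)
    {f : Fin 3 → MvPolynomial (Fin 2) k} {g₁ g₂ : MvPolynomial (Fin 2) k}
    (hf : ∀ j, (f j).IsHomogeneous d)
    (hfg : ∃ j, Ideal.span (Set.range f) = Ideal.span {g₁, g₂} ⊔ Ideal.span {f j})
    (hA : homogeneousSubmodule (Fin 2) k (2 * d - 1) ≤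
      homogeneousSubmodule (Fin 2) k (d - 1) * Submodule.span k {g₁, g₂})
    {n₀ : ℕ} (hn₀ : 0 < n₀) (hB : homogeneousSubmodule (Fin 2) k (d * n₀ + 1) ≤
      homogeneousSubmodule (Fin 2) k 1 * Submodule.span k (Set.range f) ^ n₀) :
    IsMinimalReduction (Ideal.span (Set.range f)) (Ideal.span {g₁, g₂}) ∧
      sSup (reesDepthSet (Ideal.span (Set.range f))) = 1 := by
  obtain ⟨j, hfg⟩ := hfg
  set I := Ideal.span (Set.range f)
  set J := Ideal.span {g₁, g₂}
  set m := idealOfVars (Fin 2) k with hm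
  have hJI : J ≤ I := hfg ▸ le_sup_left
  have hId : I ≤ m ^ d := by
    rw [Ideal.span_le]
    rintro _ ⟨j, rfl⟩
    rw [hm, ← idealSpan_homogeneousSubmodule]
    exact Ideal.subset_span (hf j)
  have hA' : m ^ (2 * d - 1) ≤ J * m ^ (d - 1) := by
    have := Ideal.span_mono (α := MvPolynomial (Fin 2) k) hA
    have hJ : Ideal.span (Submodule.span k {g₁, g₂} : Set (MvPolynomial (Fin 2) k)) = J :=
      Submodule.span_span_of_tower k (MvPolynomial (Fin 2) k) _
    rwa [idealSpan_coe_mul, idealSpan_homogeneousSubmodule, idealSpan_homogeneousSubmodule,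
      hJ, mul_comm _ J] at this
  have hB' : m ^ (d * n₀ + 1) ≤ I ^ n₀ := by
    have := Ideal.span_mono (α := MvPolynomial (Fin 2) k) hB
    rw [idealSpan_coe_mul, idealSpan_coe_pow, idealSpan_homogeneousSubmodule,
      idealSpan_homogeneousSubmodule] at this
    refine (this.trans Ideal.mul_le_right).trans (Ideal.pow_right_mono (le_of_eq ?_) _)
    exact Submodule.span_span_of_tower k (MvPolynomial (Fin 2) k) _
  have hB'' : ∀ n ≥ n₀, m ^ (d * n + 1) ≤ I ^ n := by
    intro n hn
    induction n, hn using Nat.le_induction with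
    | base => exact hB'
    | succ n hn ih =>
      have hdn : d ≤ d * n := Nat.le_mul_of_pos_right d (hn₀.trans_le hn)
      obtain ⟨e, he⟩ := Nat.exists_eq_add_of_le (show d - 1 ≤ d * n + 1 by omega)
      rw [show d * (n + 1) + 1 = (2 * d - 1) + e by rw [mul_add]; omega, pow_add, pow_succ']
      calc m ^ (2 * d - 1) * m ^ e ≤ J * m ^ (d - 1) * m ^ e := Ideal.mul_mono_left hA'
        _ = J * m ^ (d * n + 1) := by rw [mul_assoc, ← pow_add, ← he]
        _ ≤ I * I ^ n := Ideal.mul_mono hJI ih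
  refine ⟨IsReduction.isMinimalReduction (N := 2 * d - 1) ?_ ?_ ?_,
    sSup_reesDepthSet_eq_one (by omega) hId hB'' (not_pow_idealOfVars_le_span hd hf)⟩
  · refine IsReduction.of_mul_le (M := m ^ (d - 1)) hfg (IsNoetherian.noetherian _) ?_ ?_
    · refine pow_ne_zero _ fun h => X_ne_zero (R := k) (0 : Fin 2) ?_
      rw [← Ideal.mem_bot, ← Ideal.zero_eq_bot, ← h]
      exact Ideal.subset_span (Set.mem_range_self _)
    · refine (Ideal.mul_mono_left hId).trans (le_trans (le_of_eq ?_) hA')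
      rw [← pow_add]
      congr 1
      omega
  · exact hJI.trans (hId.trans (Ideal.pow_le_self (by omega)))
  · exact hA'.trans (Ideal.mul_le_left.trans hJI)

end Forms

section Generic

variable {k : Type*} [Field k]

/-- Forms of degree `D` are spanned by the monomials of degree `D`. -/
lemma homogeneousSubmodule_le_of_pow_mul_pow_mem {D : ℕ}
    {W : Submodule k (MvPolynomial (Fin 2) k)}
    (h : ∀ p q, p + q = D → X 0 ^ p * X 1 ^ q ∈ W) : homogeneousSubmodule (Fin 2) k D ≤ W := by
  intro f hf
  rw [f.as_sum]
  refine Submodule.sum_mem _ fun s hs => ?_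
  have hs' : s.degree = D := by
    by_contra hne
    exact mem_support_iff.1 hs (IsHomogeneous.coeff_eq_zero hf hne)
  have : monomial s (coeff s f) = coeff s f • (X 0 ^ s 0 * X 1 ^ s 1) := by
    rw [monomial_eq, Finsupp.prod_fintype _ _ (by simp), Fin.prod_univ_two, smul_eq_C_mul]
  rw [this]
  refine Submodule.smul_mem _ _ (h _ _ ?_)
  rw [← hs', Finsupp.degree_eq_sum, Fin.sum_univ_two]

lemma formOf_isHomogeneous (d : ℕ) (c : Fin (d + 1) → k) : (formOf d c).IsHomogeneous d := by
  refine IsHomogeneous.sum _ _ _ fun l _ => ?_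
  have := ((isHomogeneous_C (Fin 2) (c l)).mul (isHomogeneous_X_pow (R := k) (0 : Fin 2) l)).mul
    (isHomogeneous_X_pow (R := k) (1 : Fin 2) (d - l))
  rwa [zero_add, Nat.add_sub_cancel' (Nat.le_of_lt_succ l.2)] at this

lemma formOf_add (d : ℕ) (c c' : Fin (d + 1) → k) :
    formOf d (c + c') = formOf d c + formOf d c' := by
  simp [formOf, add_mul, Finset.sum_add_distrib]

lemma formOf_single (d : ℕ) (l : Fin (d + 1)) :
    formOf d (Pi.single l (1 : k)) = X 0 ^ (l : ℕ) * X 1 ^ (d - l) := by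
  rw [formOf, Finset.sum_eq_single_of_mem l (Finset.mem_univ l)]
  · simp
  · intro b _ hb
    simp [hb]

variable (k) in
/-- The three forms of degree `d` with indeterminate coefficients. -/
def genericForm (d : ℕ) (j : Fin 3) :
    MvPolynomial (Fin 2) (MvPolynomial ((Fin 3 × Fin (d + 1)) ⊕ (Fin 2 × Fin 3)) k) :=
  ∑ l : Fin (d + 1), C (X (.inl (j, l))) * X 0 ^ (l : ℕ) * X 1 ^ (d - (l : ℕ))

variable (k) in
/-- The two linear combinations of the generic forms with indeterminate coefficients. -/
def genericComb (d : ℕ) (i : Fin 2) :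
    MvPolynomial (Fin 2) (MvPolynomial ((Fin 3 × Fin (d + 1)) ⊕ (Fin 2 × Fin 3)) k) :=
  ∑ j : Fin 3, C (X (.inr (i, j))) * genericForm k d j

lemma specialize_C {σ : Type*} (v : σ → k) (p : MvPolynomial σ k) :
    specialize v (C p) = C (eval v p) := by
  simp [specialize, coe_aeval_eq_eval]

lemma specialize_X {σ : Type*} (v : σ → k) (i : Fin 2) : specialize v (X i) = X i := by
  simp [specialize]

lemma specialize_genericForm (d : ℕ) (v : (Fin 3 × Fin (d + 1)) ⊕ (Fin 2 × Fin 3) → k)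
    (j : Fin 3) : specialize v (genericForm k d j) = formOf d fun l => v (.inl (j, l)) := by
  simp [genericForm, formOf, specialize_C, specialize_X]

lemma specialize_genericComb (d : ℕ) (v : (Fin 3 × Fin (d + 1)) ⊕ (Fin 2 × Fin 3) → k)
    (i : Fin 2) : specialize v (genericComb k d i) =
      ∑ j : Fin 3, C (v (.inr (i, j))) * specialize v (genericForm k d j) := by
  simp [genericComb, specialize_C]

lemma map_specialize_span_range {σ ι : Type*} (v : σ → k)
    (F : ι → MvPolynomial (Fin 2) (MvPolynomial σ k)) :
    (Submodule.span k (Set.range F)).map (specialize v).toLinearMap =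
      Submodule.span k (Set.range fun i => specialize v (F i)) := by
  rw [Submodule.map_span, ← Set.range_comp]
  rfl

lemma map_specialize_span_range_X {σ : Type*} (v : σ → k) :
    (Submodule.span k (Set.range X)).map (specialize v).toLinearMap =
      homogeneousSubmodule (Fin 2) k 1 := by
  rw [map_specialize_span_range, homogeneousSubmodule_one_eq_span_X]
  simp only [specialize_X]

/-- Powers of the linear forms times powers of a space of specialised forms. -/
lemma map_specialize_pow_mul_pow {σ ι : Type*} (v : σ → k)
    (F : ι → MvPolynomial (Fin 2) (MvPolynomial σ k)) (a b : ℕ) :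
    (Submodule.span k (Set.range X) ^ a * Submodule.span k (Set.range F) ^ b).map
        (specialize v).toLinearMap =
      homogeneousSubmodule (Fin 2) k a *
        Submodule.span k (Set.range fun i => specialize v (F i)) ^ b := by
  rw [Submodule.map_mul, Submodule.map_pow, Submodule.map_pow, map_specialize_span_range_X,
    map_specialize_span_range, homogeneousSubmodule_one_pow]

lemma homogeneousSubmodule_mul_span_pow_le {ι : Type*} {d : ℕ}
    {f : ι → MvPolynomial (Fin 2) k} (hf : ∀ i, (f i).IsHomogeneous d) (a b : ℕ) :
    homogeneousSubmodule (Fin 2) k a * Submodule.span k (Set.range f) ^ b ≤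
      homogeneousSubmodule (Fin 2) k (a + d * b) := by
  have h : Submodule.span k (Set.range f) ≤ homogeneousSubmodule (Fin 2) k d :=
    Submodule.span_le.2 (Set.range_subset_iff.2 hf)
  have h' : homogeneousSubmodule (Fin 2) k d ^ b = homogeneousSubmodule (Fin 2) k (d * b) := by
    rw [← homogeneousSubmodule_one_pow k d, ← pow_mul, homogeneousSubmodule_one_pow]
  calc _ ≤ homogeneousSubmodule (Fin 2) k a * homogeneousSubmodule (Fin 2) k d ^ b :=
        mul_le_mul' le_rfl (pow_le_pow_left' h b)
    _ ≤ _ := by rw [h']; exact homogeneousSubmodule_mul _ _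

/-- Openness of `H_D = H_a · ⟨f⟩^b` for forms `f` with indeterminate coefficients. -/
lemma exists_ne_zero_forall_homogeneousSubmodule_le_mul_pow {σ ι : Type*} {d : ℕ}
    (F : ι → MvPolynomial (Fin 2) (MvPolynomial σ k))
    (hF : ∀ v i, (specialize v (F i)).IsHomogeneous d) (a b D : ℕ) (hD : a + d * b = D)
    (v₀ : σ → k) (h₀ : ∀ p q, p + q = D → (X 0 ^ p * X 1 ^ q : MvPolynomial (Fin 2) k) ∈
      homogeneousSubmodule (Fin 2) k a *
        Submodule.span k (Set.range fun i => specialize v₀ (F i)) ^ b) :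
    ∃ P : MvPolynomial σ k, P ≠ 0 ∧ ∀ v, eval v P ≠ 0 →
      homogeneousSubmodule (Fin 2) k D ≤ homogeneousSubmodule (Fin 2) k a *
        Submodule.span k (Set.range fun i => specialize v (F i)) ^ b := by
  subst hD
  obtain ⟨P, hP, h⟩ := exists_ne_zero_forall_homogeneousSubmodule_le
      (Submodule.span k (Set.range X) ^ a * Submodule.span k (Set.range F) ^ b) (a + d * b)
      (fun v => by
        rw [map_specialize_pow_mul_pow]
        exact homogeneousSubmodule_mul_span_pow_le (hF v) a b) v₀
      (by
        rw [map_specialize_pow_mul_pow]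
        exact homogeneousSubmodule_le_of_pow_mul_pow_mem h₀)
  exact ⟨P, hP, fun v hv => (h v hv).trans (map_specialize_pow_mul_pow v F a b).le⟩

variable (k) in
/-- The coefficients of `x^d`, `y^d`, `x^{d-1}y + xy^{d-1}`, combined as `x^d`, `y^d`. -/
def samplePoint (d : ℕ) : (Fin 3 × Fin (d + 1)) ⊕ (Fin 2 × Fin 3) → k :=
  Sum.elim
    (fun p => (![Pi.single (Fin.ofNat (d + 1) d) 1, Pi.single (Fin.ofNat (d + 1) 0) 1,
      Pi.single (Fin.ofNat (d + 1) (d - 1)) 1 + Pi.single (Fin.ofNat (d + 1) 1) 1] :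
        Fin 3 → Fin (d + 1) → k) p.1 p.2)
    (fun p => if (p.1 : ℕ) = p.2 then 1 else 0)

lemma specialize_samplePoint_genericForm {d : ℕ} (hd : 5 ≤ d) :
    (fun j => specialize (samplePoint k d) (genericForm k d j)) =
      ![X 0 ^ d, X 1 ^ d, X 0 ^ (d - 1) * X 1 + X 0 * X 1 ^ (d - 1)] := by
  have h1 : (d - 1) % (d + 1) = d - 1 := Nat.mod_eq_of_lt (by omega)
  have h2 : 1 % (d + 1) = 1 := Nat.mod_eq_of_lt (by omega)
  have h3 : d - (d - 1) = 1 := by omega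
  funext j
  rw [specialize_genericForm]
  fin_cases j
  · exact (formOf_single d _).trans (by simp)
  · exact (formOf_single d _).trans (by simp)
  · exact ((formOf_add d _ _).trans (congrArg₂ _ (formOf_single d _) (formOf_single d _))).trans
      (by simp [h1, h2, h3])

lemma specialize_samplePoint_genericComb {d : ℕ} (hd : 5 ≤ d) :
    (fun i => specialize (samplePoint k d) (genericComb k d i)) = ![X 0 ^ d, X 1 ^ d] := by
  have h := congrFun (specialize_samplePoint_genericForm (k := k) hd)
  funext i
  rw [specialize_genericComb, Fin.sum_univ_three, h, h, h]
  fin_cases i <;> simp [samplePoint]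

/-- Two general combinations of three general forms of degree `d` generate all forms of
degree `2d - 1`. -/
lemma exists_ne_zero_forall_le_mul_span_genericComb {d : ℕ} (hd : 5 ≤ d) :
    ∃ P : MvPolynomial ((Fin 3 × Fin (d + 1)) ⊕ (Fin 2 × Fin 3)) k, P ≠ 0 ∧
      ∀ v, eval v P ≠ 0 → homogeneousSubmodule (Fin 2) k (2 * d - 1) ≤
        homogeneousSubmodule (Fin 2) k (d - 1) *
          Submodule.span k (Set.range fun i => specialize v (genericComb k d i)) ^ 1 := by
  refine exists_ne_zero_forall_homogeneousSubmodule_le_mul_pow (d := d) (genericComb k d)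
    (fun v i => ?_) (d - 1) 1 (2 * d - 1) (by omega) (samplePoint k d) fun p q hpq => ?_
  · simp only [specialize_genericComb, specialize_genericForm]
    refine IsHomogeneous.sum _ _ _ fun j _ => ?_
    simpa using (isHomogeneous_C (Fin 2) _).mul (formOf_isHomogeneous d _)
  · rw [specialize_samplePoint_genericComb hd, pow_one]
    rcases (by omega : d ≤ p ∨ d ≤ q) with h | h
    · obtain ⟨p, rfl⟩ := Nat.exists_eq_add_of_le h
      rw [show (X 0 ^ (d + p) * X 1 ^ q : MvPolynomial (Fin 2) k) =
        X 0 ^ p * X 1 ^ q * X 0 ^ d by ring]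
      refine Submodule.mul_mem_mul ?_ (Submodule.subset_span ⟨0, rfl⟩)
      rw [show d - 1 = p + q by omega]
      exact (isHomogeneous_X_pow _ _).mul (isHomogeneous_X_pow _ _)
    · obtain ⟨q, rfl⟩ := Nat.exists_eq_add_of_le h
      rw [show (X 0 ^ p * X 1 ^ (d + q) : MvPolynomial (Fin 2) k) =
        X 0 ^ p * X 1 ^ q * X 1 ^ d by ring]
      refine Submodule.mul_mem_mul ?_ (Submodule.subset_span ⟨1, rfl⟩)
      rw [show d - 1 = p + q by omega]
      exact (isHomogeneous_X_pow _ _).mul (isHomogeneous_X_pow _ _)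

/-- The `d`-th power of three general forms of degree `d` and the linear forms generate all
forms of degree `d² + 1`. -/
lemma exists_ne_zero_forall_le_mul_span_genericForm_pow {d : ℕ} (hd : 5 ≤ d) :
    ∃ P : MvPolynomial ((Fin 3 × Fin (d + 1)) ⊕ (Fin 2 × Fin 3)) k, P ≠ 0 ∧
      ∀ v, eval v P ≠ 0 → homogeneousSubmodule (Fin 2) k (d * d + 1) ≤
        homogeneousSubmodule (Fin 2) k 1 *
          Submodule.span k (Set.range fun j => specialize v (genericForm k d j)) ^ d := by
  refine exists_ne_zero_forall_homogeneousSubmodule_le_mul_pow (d := d) (genericForm k d)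
    (fun v i => ?_) 1 d (d * d + 1) (by omega) (samplePoint k d) fun p q hpq => ?_
  · rw [specialize_genericForm]
    exact formOf_isHomogeneous d _
  · rw [specialize_samplePoint_genericForm hd]
    obtain ⟨e, rfl⟩ := Nat.exists_eq_add_of_le' (show 1 ≤ d by omega)
    have hV : ∀ j, (![X 0 ^ (e + 1), X 1 ^ (e + 1), X 0 ^ e * X 1 + X 0 * X 1 ^ e] :
        Fin 3 → MvPolynomial (Fin 2) k) j ∈ Submodule.span k (Set.range
          ![X 0 ^ (e + 1), X 1 ^ (e + 1), X 0 ^ e * X 1 + X 0 * X 1 ^ e]) := fun j =>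
      Submodule.subset_span (Set.mem_range_self j)
    rw [Nat.add_sub_cancel]
    exact pow_mul_pow_mem_mul_pow_of_add_eq (by omega) (isHomogeneous_X k 0) (isHomogeneous_X k 1)
      (hV 0) (hV 1) (hV 2) hpq

/-- Two combinations of three elements together with the third element generate the same ideal
if the leading minor of the coefficients does not vanish. -/
lemma idealSpan_range_eq_sup {f : Fin 3 → MvPolynomial (Fin 2) k} {u : Fin 2 → Fin 3 → k}
    (hu : u 0 0 * u 1 1 - u 0 1 * u 1 0 ≠ 0) :
    Ideal.span (Set.range f) =
      Ideal.span {∑ j, C (u 0 j) * f j, ∑ j, C (u 1 j) * f j} ⊔ Ideal.span {f 2} := by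
  set J := Ideal.span {∑ j, C (u 0 j) * f j, ∑ j, C (u 1 j) * f j} ⊔ Ideal.span {f 2} with hJ
  have h0 : ∑ j, C (u 0 j) * f j ∈ J :=
    Ideal.mem_sup_left (Ideal.subset_span (Set.mem_insert _ _))
  have h1 : ∑ j, C (u 1 j) * f j ∈ J :=
    Ideal.mem_sup_left (Ideal.subset_span (Set.mem_insert_of_mem _ rfl))
  have h2 : f 2 ∈ J := Ideal.mem_sup_right (Ideal.mem_span_singleton_self _)
  apply le_antisymm
  · have hunit : IsUnit (C (u 0 0 * u 1 1 - u 0 1 * u 1 0) : MvPolynomial (Fin 2) k) :=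
      (Ne.isUnit hu).map C
    rw [Ideal.span_le, Set.range_subset_iff]
    intro j
    fin_cases j
    · refine (Ideal.unit_mul_mem_iff_mem _ hunit).1 ?_
      have : C (u 0 0 * u 1 1 - u 0 1 * u 1 0) * f 0 =
          C (u 1 1) * ∑ j, C (u 0 j) * f j - C (u 0 1) * ∑ j, C (u 1 j) * f j +
            C (u 0 1 * u 1 2 - u 1 1 * u 0 2) * f 2 := by
        simp only [Fin.sum_univ_three, map_sub, map_mul]
        ring
      exact this ▸ add_mem (sub_mem (J.mul_mem_left _ h0) (J.mul_mem_left _ h1))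
        (J.mul_mem_left _ h2)
    · refine (Ideal.unit_mul_mem_iff_mem _ hunit).1 ?_
      have : C (u 0 0 * u 1 1 - u 0 1 * u 1 0) * f 1 =
          C (u 0 0) * ∑ j, C (u 1 j) * f j - C (u 1 0) * ∑ j, C (u 0 j) * f j +
            C (u 1 0 * u 0 2 - u 0 0 * u 1 2) * f 2 := by
        simp only [Fin.sum_univ_three, map_sub, map_mul]
        ring
      exact this ▸ add_mem (sub_mem (J.mul_mem_left _ h1) (J.mul_mem_left _ h0))
        (J.mul_mem_left _ h2)
    · exact h2
  · have hf : ∀ j, f j ∈ Ideal.span (Set.range f) := fun j =>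
      Ideal.subset_span (Set.mem_range_self j)
    have hs : ∀ i, ∑ j, C (u i j) * f j ∈ Ideal.span (Set.range f) := fun i =>
      Ideal.sum_mem _ fun j _ => Ideal.mul_mem_left _ _ (hf j)
    rw [hJ, sup_le_iff, Ideal.span_le, Ideal.span_le, Set.insert_subset_iff,
      Set.singleton_subset_iff, Set.singleton_subset_iff]
    exact ⟨⟨hs 0, hs 1⟩, hf 2⟩

end Generic

/-- For an infinite field `k` and `d ≥ 5`, for general forms `f₁, f₂, f₃` of degree `d`
in `R = k[x,y]` together with two general `k`-linear combinations `g₁, g₂` of them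
(genericity of the coefficient data encoded as the nonvanishing locus of a nonzero
polynomial), with `I = (f₁,f₂,f₃)`, the ideal `J = (g₁,g₂)` is a minimal reduction of
`I`, and if `Σ_{ℓ=3}^{d−1} λ(I^ℓ/JI^{ℓ−1})` exceeds `d(d−2)/8 + max{d/2−5,0}` (`d` even),
resp. `(d+1)(d−1)/8 − 2` (`d` odd), then the Rees algebra `R[It]` has depth one. -/
theorem huckaba_marley_test_general_binary_forms (k : Type*) [Field k] [Infinite k]
    (d : ℕ) (hd : 5 ≤ d) :
    ∃ P : MvPolynomial ((Fin 3 × Fin (d + 1)) ⊕ (Fin 2 × Fin 3)) k, P ≠ 0 ∧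
      ∀ (c : Fin 3 → Fin (d + 1) → k) (u : Fin 2 → Fin 3 → k),
        eval (Sum.elim (fun p => c p.1 p.2) (fun p => u p.1 p.2)) P ≠ 0 →
          IsMinimalReduction
            (Ideal.span {formOf d (c 0), formOf d (c 1), formOf d (c 2)})
            (Ideal.span {∑ j : Fin 3, C (u 0 j) * formOf d (c j),
                          ∑ j : Fin 3, C (u 1 j) * formOf d (c j)}) ∧
          ((∑ ℓ ∈ Finset.Icc 3 (d - 1),
              moduleLength (MvPolynomial (Fin 2) k)
                (powQuot (Ideal.span {formOf d (c 0), formOf d (c 1), formOf d (c 2)})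
                  (Ideal.span {∑ j : Fin 3, C (u 0 j) * formOf d (c j),
                                ∑ j : Fin 3, C (u 1 j) * formOf d (c j)}) ℓ))
              > (HMbound d : ℕ∞) →
            sSup (reesDepthSet (Ideal.span {formOf d (c 0), formOf d (c 1), formOf d (c 2)}))
              = 1) := by
  obtain ⟨PA, hPA, hA⟩ := exists_ne_zero_forall_le_mul_span_genericComb (k := k) hd
  obtain ⟨PB, hPB, hB⟩ := exists_ne_zero_forall_le_mul_span_genericForm_pow (k := k) hd
  let m : Fin 2 → Fin 3 → MvPolynomial ((Fin 3 × Fin (d + 1)) ⊕ (Fin 2 × Fin 3)) k :=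
    fun i j => X (.inr (i, j))
  have hm : m 0 0 * m 1 1 - m 0 1 * m 1 0 ≠ 0 := fun h => by
    simpa [m, samplePoint] using congrArg (eval (samplePoint k d)) h
  refine ⟨PA * PB * (m 0 0 * m 1 1 - m 0 1 * m 1 0), mul_ne_zero (mul_ne_zero hPA hPB) hm,
    fun c u hcu => ?_⟩
  rw [map_mul, map_mul] at hcu
  have hA := hA _ (left_ne_zero_of_mul (left_ne_zero_of_mul hcu))
  have hB := hB _ (right_ne_zero_of_mul (left_ne_zero_of_mul hcu))
  have hu : u 0 0 * u 1 1 - u 0 1 * u 1 0 ≠ 0 := by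
    simpa [m] using right_ne_zero_of_mul hcu
  simp only [specialize_genericComb, specialize_genericForm, Sum.elim_inl, Sum.elim_inr,
    pow_one] at hA hB
  have hI : ({formOf d (c 0), formOf d (c 1), formOf d (c 2)} : Set (MvPolynomial (Fin 2) k)) =
      Set.range fun j => formOf d (c j) := by
    ext z
    simp [Fin.exists_fin_succ, eq_comm]
  have hJ : (Set.range fun i => ∑ j : Fin 3, C (u i j) * formOf d (c j)) =
      {∑ j : Fin 3, C (u 0 j) * formOf d (c j), ∑ j : Fin 3, C (u 1 j) * formOf d (c j)} := by
    ext z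
    simp [Fin.exists_fin_two, eq_comm]
  rw [hJ] at hA
  rw [hI]
  have key := isMinimalReduction_and_sSup_reesDepthSet_eq_one hd
    (fun j => formOf_isHomogeneous d (c j)) ⟨2, idealSpan_range_eq_sup hu⟩ hA (by omega) hB
  exact ⟨key.1, fun _ => key.2⟩
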